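/- arXiv:1812.01883 — 2 statements merged into one kernel-verified Lean document; each statement's English description precedes it below -/
import Mathlib

section
/- Let R be a commutative ring, T ∈ R, and N a natural number. Define X_N = Σ_{k=0}^{⌊N/2⌋} C(N,2k)·(T²−1)^k·T^{N−2k} and Y_N = Σ_{k=0}^{⌊N/2⌋} C(N,2k+1)·(T²−1)^k·T^{N−1−2k}, where C(N,j) denotes the binomial coefficient. Then X_N² − (T²−1)·Y_N² = 1. -/
open Finset

/-- `X_N = Σ_{k=0}^{⌊N/2⌋} C(N,2k)·(T²−1)^k·T^{N−2k}`. -/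
noncomputable def pellX {R : Type*} [CommRing R] (T : R) (N : ℕ) : R :=
  ∑ k ∈ Finset.range (N / 2 + 1),
    (N.choose (2 * k) : R) * (T ^ 2 - 1) ^ k * T ^ (N - 2 * k)

/-- `Y_N = Σ_{k=0}^{⌊N/2⌋} C(N,2k+1)·(T²−1)^k·T^{N−1−2k}`. -/
noncomputable def pellY {R : Type*} [CommRing R] (T : R) (N : ℕ) : R :=
  ∑ k ∈ Finset.range (N / 2 + 1),
    (N.choose (2 * k + 1) : R) * (T ^ 2 - 1) ^ k * T ^ (N - 1 - 2 * k)

lemma pellX_ext {R : Type*} [CommRing R] (T : R) (N M : ℕ) (h : N / 2 + 1 ≤ M) :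
    pellX T N = ∑ k ∈ Finset.range M,
      (N.choose (2 * k) : R) * (T ^ 2 - 1) ^ k * T ^ (N - 2 * k) := by
  unfold pellX
  apply Finset.sum_subset (Finset.range_mono h)
  intro k _ hk
  rw [Finset.mem_range] at hk
  rw [Nat.choose_eq_zero_of_lt (by omega)]
  simp

lemma pellY_ext {R : Type*} [CommRing R] (T : R) (N M : ℕ) (h : N / 2 + 1 ≤ M) :
    pellY T N = ∑ k ∈ Finset.range M,
      (N.choose (2 * k + 1) : R) * (T ^ 2 - 1) ^ k * T ^ (N - 1 - 2 * k) := by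
  unfold pellY
  apply Finset.sum_subset (Finset.range_mono h)
  intro k _ hk
  rw [Finset.mem_range] at hk
  rw [Nat.choose_eq_zero_of_lt (by omega)]
  simp

lemma pellX_succ {R : Type*} [CommRing R] (T : R) (N : ℕ) :
    pellX T (N + 1) = T * pellX T N + (T ^ 2 - 1) * pellY T N := by
  rw [pellX_ext T (N + 1) (N + 1 + 1) (by omega), pellX_ext T N (N + 1 + 1) (by omega),
    pellY_ext T N (N + 1) (by omega), Finset.sum_range_succ', Finset.sum_range_succ' _ (N + 1),
    mul_add, Finset.mul_sum, Finset.mul_sum, add_right_comm, ← Finset.sum_add_distrib]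
  congr 1
  · apply Finset.sum_congr rfl
    intro k _
    have e : (N + 1).choose (2 * (k + 1)) = N.choose (2 * k + 1) + N.choose (2 * (k + 1)) :=
      Nat.choose_succ_succ N (2 * k + 1)
    have e2 : N + 1 - 2 * (k + 1) = N - 1 - 2 * k := by omega
    rw [e, e2]
    push_cast
    by_cases h : 2 * (k + 1) ≤ N
    · have e3 : N - 1 - 2 * k = (N - 2 * (k + 1)) + 1 := by omega
      rw [e3]
      ring
    · rw [Nat.choose_eq_zero_of_lt (show N < 2 * (k + 1) by omega)]
      push_cast
      ring
  · simp [pow_succ']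

lemma pellY_succ {R : Type*} [CommRing R] (T : R) (N : ℕ) :
    pellY T (N + 1) = pellX T N + T * pellY T N := by
  rw [pellY_ext T (N + 1) (N + 1) (by omega), pellX_ext T N (N + 1) (by omega),
    pellY_ext T N (N + 1) (by omega), Finset.mul_sum, ← Finset.sum_add_distrib]
  apply Finset.sum_congr rfl
  intro k _
  rw [Nat.choose_succ_succ' N (2 * k), Nat.add_sub_cancel]
  push_cast
  by_cases h : 2 * k + 1 ≤ N
  · have e3 : N - 2 * k = (N - 1 - 2 * k) + 1 := by omega
    rw [e3]
    ring
  · rw [Nat.choose_eq_zero_of_lt (show N < 2 * k + 1 by omega)]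
    push_cast
    ring

/-- The pair `(X_N, Y_N)` solves the Pell equation `X² − (T²−1)·Y² = 1`. -/
theorem pellXY_solves {R : Type*} [CommRing R] (T : R) (N : ℕ) :
    pellX T N ^ 2 - (T ^ 2 - 1) * pellY T N ^ 2 = 1 := by
  induction N with
  | zero => simp [pellX, pellY]
  | succ N ih =>
    rw [pellX_succ, pellY_succ]
    linear_combination ih
end

section
/- Let F be a field of characteristic zero and let T ∈ F[t] be a nonconstant polynomial. Suppose the polynomials X, Y, Z, V, U ∈ F[t] satisfy the system X² − (T²−1)Y² = 1, Y − (T−1)Z = V, and V·U = 1. Then there exists an integer N (necessarily nonzero) such that V equals the constant polynomial N·1, and Y − N·1 = (T−1)·Z. -/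
open Polynomial

lemma pell_aux {F : Type*} [Field F] [CharZero F] (T : Polynomial F) (hT : 0 < T.natDegree)
    (n : ℕ) : ∀ X Y : Polynomial F, Y.degree < (n : WithBot ℕ) →
    X ^ 2 - (T ^ 2 - 1) * Y ^ 2 = 1 →
    ∃ e N : ℤ, (T - 1) ∣ X - (e : Polynomial F) ∧ (T - 1) ∣ Y - (N : Polynomial F) := by
  induction n with
  | zero =>
    intro X Y hY h
    have hY0 : Y = 0 := by
      rw [← degree_eq_bot]
      by_contra hne
      have h0 : Y ≠ 0 := fun h => hne (by simp [h])
      rw [degree_eq_natDegree h0] at hY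
      have := Nat.cast_lt.mp hY
      omega
    subst hY0
    have : (X - 1) * (X + 1) = 0 := by linear_combination h
    rcases mul_eq_zero.mp this with h | h
    · exact ⟨1, 0, by simp [h], by simp⟩
    · exact ⟨-1, 0, by simp [h], by simp⟩
  | succ n ih =>
    intro X Y hY h
    by_cases hY0 : Y = 0
    · exact ih X Y (by rw [hY0, degree_zero]; exact WithBot.bot_lt_coe n) h
    have hYn : Y.natDegree ≤ n := by
      rw [degree_eq_natDegree hY0] at hY
      have := Nat.cast_lt.mp hY
      omega
    have hYd : Y.degree ≤ (n : WithBot ℕ) := by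
      rw [degree_eq_natDegree hY0]; exact_mod_cast hYn
    have key : (T * Y - X).degree < Y.degree ∨ (T * Y + X).degree < Y.degree := by
      by_contra! hc
      obtain ⟨hA, hB⟩ := hc
      have hA0 : T * Y - X ≠ 0 := by
        intro h0; rw [h0, degree_zero, le_bot_iff, degree_eq_bot] at hA; exact hY0 hA
      have hB0 : T * Y + X ≠ 0 := by
        intro h0; rw [h0, degree_zero, le_bot_iff, degree_eq_bot] at hB; exact hY0 hB
      have hA1 := natDegree_le_natDegree hA
      have hB1 := natDegree_le_natDegree hB
      have hm : (T * Y - X) * (T * Y + X) = Y ^ 2 - 1 := by linear_combination -h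
      have hd := natDegree_mul hA0 hB0
      have hd2 : (Y ^ 2 - 1).natDegree ≤ 2 * Y.natDegree := by
        refine (natDegree_sub_le _ _).trans ?_
        simp
      rw [hm] at hd
      have hs : (T * Y - X) + (T * Y + X) = C 2 * (T * Y) := by
        rw [show (C (2 : F)) = 2 from rfl]; ring
      have hs1 := natDegree_add_le (T * Y - X) (T * Y + X)
      have hT0 : T ≠ 0 := by rintro rfl; simp at hT
      rw [hs, natDegree_C_mul (by norm_num), natDegree_mul hT0 hY0] at hs1
      rcases le_max_iff.mp hs1 with h | h <;> omega
    rcases key with hk | hk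
    · obtain ⟨e, M, ⟨a, ha⟩, ⟨b, hb⟩⟩ := ih (T * X - (T ^ 2 - 1) * Y) (T * Y - X)
        (hk.trans_le hYd) (by linear_combination h)
      refine ⟨e, M + e, ⟨T * a + e + (T + 1) * (T * Y - X), ?_⟩,
        ⟨a + T * b + M, ?_⟩⟩
      · linear_combination T * ha
      · push_cast
        linear_combination ha + T * hb
    · obtain ⟨e, M, ⟨a, ha⟩, ⟨b, hb⟩⟩ := ih (T * X + (T ^ 2 - 1) * Y) (T * Y + X)
        (hk.trans_le hYd) (by linear_combination h)
      refine ⟨e, M - e, ⟨T * a + e - (T + 1) * (T * Y + X), ?_⟩,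
        ⟨-a + T * b + M, ?_⟩⟩
      · linear_combination T * ha
      · push_cast
        linear_combination -ha + T * hb

/-- If `T ∈ F[t]` is nonconstant (`F` a field of characteristic zero) and
`X, Y, Z, V, U ∈ F[t]` satisfy the short system `X² − (T²−1)Y² = 1`,
`Y − (T−1)Z = V`, `V·U = 1`, then `V` is the constant polynomial given by
some nonzero integer `N`, and `Y − N·1 = (T−1)·Z`. -/
theorem short_system_V_is_integer {F : Type*} [Field F] [CharZero F]
    (T X Y Z V U : Polynomial F) (hT : 0 < T.natDegree)
    (h1 : X ^ 2 - (T ^ 2 - 1) * Y ^ 2 = 1)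
    (h2 : Y - (T - 1) * Z = V)
    (h3 : V * U = 1) :
    ∃ N : ℤ, N ≠ 0 ∧ V = (N : Polynomial F) ∧
      Y - (N : Polynomial F) = (T - 1) * Z := by
  obtain ⟨e, N, -, ⟨b, hb⟩⟩ := pell_aux T hT (Y.natDegree + 1) X Y
    (degree_le_natDegree.trans_lt (by exact_mod_cast Nat.lt_succ_self _)) h1
  have hV : V.natDegree = 0 := natDegree_eq_zero_of_isUnit (IsUnit.of_mul_eq_one U h3)
  have hdvd : (T - 1) ∣ V - (N : Polynomial F) := ⟨b - Z, by linear_combination hb - h2⟩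
  have hVN : V = (N : Polynomial F) := by
    by_contra hne
    have hle := natDegree_le_of_dvd hdvd (sub_ne_zero.mpr hne)
    have ha : (T - 1).natDegree = T.natDegree := by
      simpa using natDegree_sub_C (p := T) (a := (1 : F))
    have hc := natDegree_sub_le V (N : Polynomial F)
    rw [hV, natDegree_intCast] at hc
    simp at hc
    omega
  refine ⟨N, ?_, hVN, ?_⟩
  · rintro rfl
    rw [hVN] at h3
    simp at h3
  · linear_combination h2 + hVN
end
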